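/- (BRP test, Theorem 1: full characterization.) Let X, A be finite nonempty sets, μ a prior on X, and p_1,…,p_K stochastic kernels from X to A (the dataset). The following are equivalent. (I) There exist a finite nonempty set Y, stochastic kernels α_1,…,α_K from X to Y, decision rules β_1,…,β_K from Y to A, nonnegative utilities u_1,…,u_K : X × A → ℝ, and a function C from stochastic kernels (X to Y) to ℝ such that for every k: (i) p_k(a|x) = ∑_{y∈Y} β_k(a|y) α_k(y|x) for all a ∈ A and all x ∈ X with μ(x) > 0; (ii) β_k is an optimal decision rule for (μ, α_k, u_k); (iii) J(μ, α_k, u_k) − C(α_k) ≥ J(μ, α, u_k) − C(α) for every stochastic kernel α from X to Y. (II) There exist nonnegative utilities u_1,…,u_K : X × A → ℝ and reals c_1,…,c_K such that each joint q_k(x,a) = μ(x) p_k(a|x) satisfies NIAS for u_k and q_1,…,q_K, u_1,…,u_K, c_1,…,c_K satisfy NIAC. -/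

import Mathlib

open Finset

/-- A stochastic kernel from `S` to `T`: `κ s t` is the probability of `t` given `s`. -/
def IsKernel {S T : Type*} [Fintype T] (κ : S → T → ℝ) : Prop :=
  (∀ s t, 0 ≤ κ s t) ∧ ∀ s, ∑ t, κ s t = 1

/-- A prior on a finite set `X`. -/
def IsPrior {X : Type*} [Fintype X] (μ : X → ℝ) : Prop :=
  (∀ x, 0 ≤ μ x) ∧ ∑ x, μ x = 1

/-- Maximum of a real-valued function over a finite nonempty type. -/
noncomputable def maxOver {A : Type*} [Fintype A] [Nonempty A] (f : A → ℝ) : ℝ :=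
  Finset.univ.sup' Finset.univ_nonempty f

/-- Maximal expected utility of attention strategy `α` under prior `μ` and utility `u`. -/
noncomputable def J {X Y A : Type*} [Fintype X] [Fintype Y] [Fintype A] [Nonempty A]
    (μ : X → ℝ) (α : X → Y → ℝ) (u : X → A → ℝ) : ℝ :=
  ∑ y, maxOver (fun a => ∑ x, μ x * α x y * u x a)

/-- Maximal expected utility of a direct strategy `p : X → A`. -/
noncomputable def JA {X A : Type*} [Fintype X] [Fintype A] [Nonempty A]
    (μ : X → ℝ) (p : X → A → ℝ) (u : X → A → ℝ) : ℝ :=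
  ∑ a, maxOver (fun b => ∑ x, μ x * p x a * u x b)

/-- `β` is an optimal decision rule for `(μ, α, u)`. -/
def OptimalRule {X Y A : Type*} [Fintype X] (μ : X → ℝ) (α : X → Y → ℝ)
    (u : X → A → ℝ) (β : Y → A → ℝ) : Prop :=
  ∀ y a, 0 < β y a → ∀ b, ∑ x, μ x * α x y * u x b ≤ ∑ x, μ x * α x y * u x a

/-- The NIAS (No-Improving-Action-Switches) inequalities. -/
def NIAS {X A : Type*} [Fintype X] (q u : X → A → ℝ) : Prop :=
  ∀ a b, ∑ x, q x a * (u x b - u x a) ≤ 0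

/-- The NIAC (No-Improving-Action-Cycles) inequalities for a collection of agents. -/
def NIAC {K X A : Type*} [Fintype X] [Fintype A] [Nonempty A]
    (q u : K → X → A → ℝ) (c : K → ℝ) : Prop :=
  ∀ j k, (∑ a, maxOver (fun b => ∑ x, q j x a * u k x b)) - c j
    - (∑ x, ∑ a, q k x a * u k x a) + c k ≤ 0

theorem le_maxOver {A : Type*} [Fintype A] [Nonempty A] (f : A → ℝ) (a : A) :
    f a ≤ maxOver f :=
  Finset.le_sup' f (Finset.mem_univ a)

theorem maxOver_le {A : Type*} [Fintype A] [Nonempty A] {f : A → ℝ} {c : ℝ}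
    (h : ∀ a, f a ≤ c) : maxOver f ≤ c :=
  Finset.sup'_le _ _ fun a _ => h a

theorem maxOver_eq {A : Type*} [Fintype A] [Nonempty A] {f : A → ℝ} {a : A}
    (h : ∀ b, f b ≤ f a) : maxOver f = f a :=
  le_antisymm (maxOver_le h) (le_maxOver f a)

/-- Garbling the signal does not increase the total of the signalwise maxima. -/
theorem sum_maxOver_garbling_le {Y A : Type*} [Fintype Y] [Fintype A] [Nonempty A]
    {β : Y → A → ℝ} (hβ : IsKernel β) (v : Y → A → ℝ) :
    ∑ a, maxOver (fun b => ∑ y, β y a * v y b) ≤ ∑ y, maxOver (v y) :=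
  calc ∑ a, maxOver (fun b => ∑ y, β y a * v y b)
      ≤ ∑ a, ∑ y, β y a * maxOver (v y) :=
        Finset.sum_le_sum fun a _ => maxOver_le fun b => Finset.sum_le_sum fun y _ =>
          mul_le_mul_of_nonneg_left (le_maxOver (v y) b) (hβ.1 y a)
    _ = ∑ y, maxOver (v y) := by
        rw [Finset.sum_comm]
        simp_rw [← Finset.sum_mul, hβ.2, one_mul]

/-- A decision rule supported on maximizers attains the total of the signalwise maxima. -/
theorem sum_maxOver_eq_of_optimal {Y A : Type*} [Fintype Y] [Fintype A] [Nonempty A]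
    {β : Y → A → ℝ} (hβ : IsKernel β) {v : Y → A → ℝ}
    (h : ∀ y a, 0 < β y a → ∀ b, v y b ≤ v y a) :
    ∑ y, maxOver (v y) = ∑ a, ∑ y, β y a * v y a := by
  rw [Finset.sum_comm]
  refine Finset.sum_congr rfl fun y _ => ?_
  rw [← one_mul (maxOver (v y)), ← hβ.2 y, Finset.sum_mul]
  refine Finset.sum_congr rfl fun a _ => ?_
  rcases (hβ.1 y a).eq_or_lt with h0 | h0
  · simp [← h0]
  · rw [maxOver_eq (h y a h0)]

/-- Integrating against the joint of a mixed strategy is mixing the signalwise integrals. -/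
theorem sum_joint_mul {X Y A : Type*} [Fintype X] [Fintype Y] {μ : X → ℝ} (hμ : ∀ x, 0 ≤ μ x)
    {p : X → A → ℝ} {α : X → Y → ℝ} {β : Y → A → ℝ}
    (hp : ∀ a x, 0 < μ x → p x a = ∑ y, β y a * α x y) (a : A) (w : X → ℝ) :
    ∑ x, μ x * p x a * w x = ∑ y, β y a * ∑ x, μ x * α x y * w x := by
  simp_rw [Finset.mul_sum]
  rw [Finset.sum_comm]
  refine Finset.sum_congr rfl fun x _ => ?_
  rcases (hμ x).eq_or_lt with h0 | h0
  · simp [← h0]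
  · rw [hp a x h0, Finset.mul_sum, Finset.sum_mul]
    exact Finset.sum_congr rfl fun y _ => by ring

theorem nias_iff {X A : Type*} [Fintype X] {q u : X → A → ℝ} :
    NIAS q u ↔ ∀ a b, ∑ x, q x a * u x b ≤ ∑ x, q x a * u x a := by
  simp [NIAS, mul_sub, Finset.sum_sub_distrib]

theorem J_comp_equiv {X Y A : Type*} [Fintype X] [Fintype Y] [Fintype A] [Nonempty A]
    (e : Y ≃ A) (μ : X → ℝ) (p u : X → A → ℝ) :
    J μ (fun x y => p x (e y)) u = JA μ p u :=
  e.sum_comp fun a => maxOver fun b => ∑ x, μ x * p x a * u x b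

theorem NIAS.JA_eq {X A : Type*} [Fintype X] [Fintype A] [Nonempty A] {μ : X → ℝ}
    {p u : X → A → ℝ} (h : NIAS (fun x a => μ x * p x a) u) :
    JA μ p u = ∑ x, ∑ a, μ x * p x a * u x a := by
  rw [Finset.sum_comm]
  exact Finset.sum_congr rfl fun a _ => maxOver_eq (nias_iff.1 h a)

/-- BRP test, Theorem 1: a dataset of stochastic choice kernels is
rationalized by a rationally inattentive utility-maximization (UMRI) model if and only if
there exist nonnegative utilities and costs satisfying NIAS and NIAC. -/
theorem brp_characterization {X A K : Type*} [Fintype X] [Nonempty X]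
    [Fintype A] [Nonempty A] [Fintype K] [Nonempty K]
    (μ : X → ℝ) (hμ : IsPrior μ)
    (p : K → X → A → ℝ) (hp : ∀ k, IsKernel (p k)) :
    (∃ (Y : Type) (hY : Fintype Y) (hYne : Nonempty Y),
      letI := hY; letI := hYne;
      ∃ (α : K → X → Y → ℝ) (β : K → Y → A → ℝ)
        (u : K → X → A → ℝ) (C : (X → Y → ℝ) → ℝ),
        (∀ k, IsKernel (α k)) ∧
        (∀ k, IsKernel (β k)) ∧
        (∀ k x a, 0 ≤ u k x a) ∧
        (∀ k a x, 0 < μ x → p k x a = ∑ y, β k y a * α k x y) ∧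
        (∀ k, OptimalRule μ (α k) (u k) (β k)) ∧
        (∀ k, ∀ α' : X → Y → ℝ, IsKernel α' →
          J μ α' (u k) - C α' ≤ J μ (α k) (u k) - C (α k)))
    ↔
    (∃ (u : K → X → A → ℝ) (c : K → ℝ),
      (∀ k x a, 0 ≤ u k x a) ∧
      (∀ k, NIAS (fun x a => μ x * p k x a) (u k)) ∧
      NIAC (fun k x a => μ x * p k x a) u c) := by
  classical
  constructor
  · rintro ⟨Y, hY, hYne, α, β, u, C, hα, hβ, hu, hp', hopt, hC⟩
    refine ⟨u, fun k => C (α k), hu, fun k => nias_iff.2 fun a b => ?_, fun j k => ?_⟩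
    · rw [sum_joint_mul hμ.1 (hp' k) a fun x => u k x b,
        sum_joint_mul hμ.1 (hp' k) a fun x => u k x a]
      refine Finset.sum_le_sum fun y _ => ?_
      rcases ((hβ k).1 y a).eq_or_lt with h0 | h0
      · simp [← h0]
      · exact mul_le_mul_of_nonneg_left (hopt k y a h0 b) h0.le
    · have hgarble : ∑ a, maxOver (fun b => ∑ x, μ x * p j x a * u k x b) ≤ J μ (α j) (u k) := by
        simp_rw [fun a b => sum_joint_mul hμ.1 (hp' j) a fun x => u k x b]
        exact sum_maxOver_garbling_le (hβ j) fun y b => ∑ x, μ x * α j x y * u k x b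
      have hvalue : J μ (α k) (u k) = ∑ x, ∑ a, μ x * p k x a * u k x a := by
        rw [Finset.sum_comm]
        simp_rw [fun a => sum_joint_mul hμ.1 (hp' k) a fun x => u k x a]
        exact sum_maxOver_eq_of_optimal (hβ k) (hopt k)
      have := hC k (α j) (hα j)
      dsimp only
      linarith
  · rintro ⟨u, c, hu, hnias, hniac⟩
    let e : Fin (Fintype.card A) ≃ A := (Fintype.equivFin A).symm
    let α : K → X → Fin (Fintype.card A) → ℝ := fun k x y => p k x (e y)
    let C : (X → Fin (Fintype.card A) → ℝ) → ℝ := fun α' =>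
      maxOver fun k => J μ α' (u k) - J μ (α k) (u k) + c k
    have hJ : ∀ j k, J μ (α j) (u k) - c j ≤ J μ (α k) (u k) - c k := fun j k => by
      have h := hniac j k
      have h₁ : J μ (α j) (u k) = _ := J_comp_equiv e μ (p j) (u k)
      have h₂ : J μ (α k) (u k) = _ := (J_comp_equiv e μ (p k) (u k)).trans (hnias k).JA_eq
      rw [h₁, h₂]
      unfold JA
      dsimp only at h
      linarith
    have hCα : ∀ k, C (α k) ≤ c k := fun k => maxOver_le fun j => by linarith [hJ k j]
    refine ⟨Fin (Fintype.card A), inferInstance, ⟨e.symm (Classical.arbitrary A)⟩, α,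
      fun _ y a => if a = e y then 1 else 0, u, C, fun k => ⟨fun x y => (hp k).1 x (e y), ?_⟩,
      fun k => ⟨fun y a => ?_, fun y => by simp⟩, hu, fun k a x _ => ?_, fun k y a hy b => ?_,
      fun k α' _ => ?_⟩
    · exact fun x => (e.sum_comp (p k x)).trans ((hp k).2 x)
    · dsimp only
      split_ifs <;> norm_num
    · simpa using (e.sum_comp fun a' => (if a = a' then (1 : ℝ) else 0) * p k x a').symm
    · obtain rfl : a = e y := by
        by_contra hne
        simp [hne] at hy
      exact nias_iff.1 (hnias k) (e y) b
    · have := le_maxOver (fun j => J μ α' (u j) - J μ (α j) (u j) + c j) k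
      linarith [hCα k, show J μ α' (u k) - J μ (α k) (u k) + c k ≤ C α' from this]
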